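/- Let N ≥ 5 be an integer and let m, p be positive integers with p dividing m. Then there do not exist N+2 elements s_1, …, s_{N+2} of the complex reflection group G(m,p,N) ⊆ GL_N(ℂ) such that: (i) s_1 s_2 ⋯ s_{N+2} equals the identity matrix; (ii) s_i is a pseudoreflection for i = 1, …, N+1; (iii) s_{N+2} = μ·R for some complex scalar μ and some pseudoreflection R ∈ GL_N(ℂ) (R is not required to lie in G(m,p,N)); and (iv) s_1, …, s_{N+2} generate G(m,p,N). -/

import Mathlib

open scoped MatrixGroups

/-- An element of `GL_r(ℂ)` (here, viewed as a matrix) is a pseudoreflection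
if `g - Id` has rank 1. -/
def IsPseudoreflection {r : ℕ} (g : Matrix (Fin r) (Fin r) ℂ) : Prop :=
  (g - 1).rank = 1

/-- The complex reflection group `G(m,p,N)`: monomial `N × N` matrices whose
nonzero entries are `m`-th roots of unity, and such that the product of the
nonzero entries is an `(m/p)`-th root of unity. -/
def GmpN (m p N : ℕ) : Set (Matrix (Fin N) (Fin N) ℂ) :=
  {g | ∃ (σ : Equiv.Perm (Fin N)) (f : Fin N → ℂ),
    (∀ j, f j ^ m = 1) ∧ (∏ j, f j) ^ (m / p) = 1 ∧
    ∀ i j, g i j = if i = σ j then f j else 0}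

/-- A square matrix whose nonzero entries are exactly those in positions `(σ j, j)`. -/
def HasPermSupport {n : Type*} (A : Matrix n n ℂ) (σ : Equiv.Perm n) : Prop :=
  ∀ i j, A i j ≠ 0 ↔ i = σ j

namespace HasPermSupport

variable {n : Type*}

theorem unique {A : Matrix n n ℂ} {σ τ : Equiv.Perm n}
    (hσ : HasPermSupport A σ) (hτ : HasPermSupport A τ) : σ = τ :=
  Equiv.ext fun j => (hτ (σ j) j).1 ((hσ (σ j) j).2 rfl)

theorem one [DecidableEq n] : HasPermSupport (1 : Matrix n n ℂ) 1 := fun i j => by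
  simp [Matrix.one_apply]

theorem mul_apply [Fintype n] {B : Matrix n n ℂ} {τ : Equiv.Perm n}
    (hB : HasPermSupport B τ) (A : Matrix n n ℂ) (i j : n) :
    (A * B) i j = A i (τ j) * B (τ j) j := by
  rw [Matrix.mul_apply]
  refine Finset.sum_eq_single _ (fun k _ hk => ?_) (by simp)
  rw [not_not.1 (mt (hB k j).1 hk), mul_zero]

theorem mul [Fintype n] {A B : Matrix n n ℂ} {σ τ : Equiv.Perm n}
    (hA : HasPermSupport A σ) (hB : HasPermSupport B τ) :
    HasPermSupport (A * B) (σ * τ) := fun i j => by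
  have hj : B (τ j) j ≠ 0 := (hB _ _).2 rfl
  rw [hB.mul_apply A, Equiv.Perm.mul_apply, ← hA i (τ j)]
  simp [hj]

theorem inv [Fintype n] [DecidableEq n] {g : GL n ℂ} {σ : Equiv.Perm n}
    (hg : HasPermSupport (g : Matrix n n ℂ) σ) :
    HasPermSupport ((g⁻¹ : GL n ℂ) : Matrix n n ℂ) σ⁻¹ := fun i j => by
  have hmul : (((g⁻¹ : GL n ℂ) : Matrix n n ℂ) * (g : Matrix n n ℂ)) = 1 := by
    rw [← Units.val_mul, inv_mul_cancel, Units.val_one]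
  obtain ⟨j, rfl⟩ := σ.surjective j
  have hentry := hg.mul_apply ((g⁻¹ : GL n ℂ) : Matrix n n ℂ) i j
  have hj : (g : Matrix n n ℂ) (σ j) j ≠ 0 := (hg _ _).2 rfl
  rw [hmul] at hentry
  rw [Equiv.Perm.coe_inv, Equiv.symm_apply_apply, ← mul_ne_zero_iff_right hj, ← hentry]
  simp [Matrix.one_apply]

theorem list_prod [Fintype n] [DecidableEq n] {k : ℕ} {s : Fin k → GL n ℂ}
    {σ : Fin k → Equiv.Perm n} (h : ∀ i, HasPermSupport (s i : Matrix n n ℂ) (σ i)) :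
    HasPermSupport (((List.ofFn s).prod : GL n ℂ) : Matrix n n ℂ) (List.ofFn σ).prod := by
  induction k with
  | zero => simpa using one
  | succ k ih =>
    simp only [List.ofFn_succ, List.prod_cons, Units.val_mul]
    exact (h 0).mul (ih fun i => h i.succ)

/-- If `A - c` has rank at most one for some `c ≠ 0`, the underlying permutation moves at most
two points. -/
theorem exists_eq_swap [Fintype n] [Nonempty n] [DecidableEq n] {A : Matrix n n ℂ}
    {σ : Equiv.Perm n} (hA : HasPermSupport A σ) {c : ℂ} (hc : c ≠ 0)
    (hrank : (A - c • (1 : Matrix n n ℂ)).rank ≤ 1) : ∃ a b, σ = Equiv.swap a b := by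
  by_cases hσ : σ = 1
  · obtain ⟨a⟩ := ‹Nonempty n›
    exact ⟨a, a, by rw [hσ, Equiv.swap_self]; rfl⟩
  obtain ⟨a, ha⟩ : ∃ a, σ a ≠ a := by
    by_contra! h
    exact hσ (Equiv.ext h)
  have hfix : ∀ x, x ≠ a → x ≠ σ a → σ x = x := by
    intro x hxa hxb
    by_contra hx
    have hxa' : A x a = 0 := not_not.1 (mt (hA x a).1 hxb)
    have hxx : A x x = 0 := not_not.1 (mt (hA x x).1 (Ne.symm hx))
    have hbx : A (σ a) x = 0 :=
      not_not.1 (mt (hA (σ a) x).1 fun h => hxa (σ.injective h).symm)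
    have hba : A (σ a) a ≠ 0 := (hA _ _).2 rfl
    have hdet : ((A - c • (1 : Matrix n n ℂ)).submatrix ![σ a, x] ![a, x]).det ≠ 0 := by
      rw [Matrix.det_fin_two]
      simp [hxa', hxx, hbx, ha, hxa, Ne.symm hxb, hba, hc]
    have h2 := Matrix.rank_of_det_ne_zero hdet
    have h3 := Matrix.rank_submatrix_le (A - c • (1 : Matrix n n ℂ)) ![σ a, x] ![a, x]
    rw [Fintype.card_fin] at h2
    omega
  have hb : σ (σ a) = a := by
    by_contra h
    exact ha (σ.injective (σ.injective (hfix _ h fun h' => ha (σ.injective h'))))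
  refine ⟨a, σ a, Equiv.ext fun x => ?_⟩
  rcases eq_or_ne x a with rfl | hxa
  · rw [Equiv.swap_apply_left]
  rcases eq_or_ne x (σ a) with rfl | hxb
  · rw [Equiv.swap_apply_right, hb]
  · rw [Equiv.swap_apply_of_ne_of_ne hxa hxb, hfix x hxa hxb]

end HasPermSupport

/-- A matrix whose kernel consists of constant vectors has corank at most one. -/
theorem Matrix.card_le_rank_add_one_of_ker_const {K m n : Type*} [Field K] [Fintype m]
    [Fintype n] (A : Matrix m n K)
    (h : ∀ ψ : n → K, A.mulVec ψ = 0 → ∀ x y, ψ x = ψ y) :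
    Fintype.card n ≤ A.rank + 1 := by
  have hker : Module.finrank K (LinearMap.ker A.mulVecLin) ≤ 1 := by
    have hle : LinearMap.ker A.mulVecLin ≤ Submodule.span K {fun _ : n => (1 : K)} := by
      intro ψ hψ
      rw [Submodule.mem_span_singleton]
      rcases isEmpty_or_nonempty n with _ | ⟨⟨x⟩⟩
      · exact ⟨0, Subsingleton.elim _ _⟩
      · exact ⟨ψ x, funext fun y => by simpa using h ψ (by simpa using hψ) x y⟩
    exact (Submodule.finrank_mono hle).trans (finrank_span_le_card _ |>.trans (by simp))
  have hsum := A.mulVecLin.finrank_range_add_finrank_ker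
  rw [Module.finrank_fintype_fun_eq_card] at hsum
  change A.rank + _ = _ at hsum
  omega

/-- A product of `k` (possibly trivial) transpositions acting transitively on `n` points and
equal to the identity has `k ≥ 2 (n - 1)`. Transitivity is expressed by saying that every
invariant function is constant. -/
theorem two_mul_card_le_of_prod_swap_eq_one {α : Type*} [Fintype α] [DecidableEq α] {k : ℕ}
    (a b : Fin k → α) (hprod : (List.ofFn fun i => Equiv.swap (a i) (b i)).prod = 1)
    (htrans : ∀ ψ : α → ℚ, (∀ i, ψ (a i) = ψ (b i)) → ∀ x y, ψ x = ψ y) :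
    2 * Fintype.card α ≤ k + 2 := by
  set g : Fin k → Equiv.Perm α := fun i => Equiv.swap (a i) (b i) with hg
  let π : Fin (k + 1) → Equiv.Perm α := Fin.partialProd g
  have hπ : ∀ i : Fin k, π i.succ = π i.castSucc * g i := Fin.partialProd_succ g
  have hπ0 : π 0 = 1 := Fin.partialProd_zero g
  have hπk : π (Fin.last k) = 1 := by
    rw [← hprod]
    change ((List.ofFn g).take k).prod = _
    rw [List.take_of_length_le (by simp)]
  let A : Matrix (Fin k) α ℚ := Matrix.of fun i y =>
    (if b i = y then 1 else 0) - (if a i = y then 1 else 0)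
  let B : Matrix α (Fin k) ℚ := Matrix.of fun x i =>
    (if x = π i.castSucc (a i) then 1 else 0) - (if x = π i.castSucc (b i) then 1 else 0)
  have hA : Fintype.card α ≤ A.rank + 1 := by
    refine A.card_le_rank_add_one_of_ker_const fun ψ hψ => htrans ψ fun i => ?_
    have hi := congrFun hψ i
    simp [A, Matrix.mulVec, dotProduct, sub_mul, Finset.sum_sub_distrib] at hi
    linarith
  have hB : Fintype.card α ≤ B.transpose.rank + 1 := by
    refine B.transpose.card_le_rank_add_one_of_ker_const fun ψ hψ => htrans ψ ?_
    have hstep : ∀ i : Fin k, ψ (π i.castSucc (a i)) = ψ (π i.castSucc (b i)) := by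
      intro i
      have hi := congrFun hψ i
      simp [B, Matrix.mulVec, dotProduct, sub_mul, Finset.sum_sub_distrib] at hi
      linarith
    have hinv : ∀ j : Fin (k + 1), ∀ x, ψ (π j x) = ψ x := by
      intro j
      induction j using Fin.induction with
      | zero => simp [hπ0]
      | succ i ih =>
        intro x
        rw [hπ, Equiv.Perm.mul_apply, ih]
        have hi := hstep i
        rw [ih, ih] at hi
        simp only [hg, Equiv.swap_apply_def]
        split_ifs <;> simp_all
    intro i
    rw [← hinv i.castSucc (a i), ← hinv i.castSucc (b i), hstep]
  have hBA : B * A = 0 := by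
    ext x y
    have hterm : ∀ i : Fin k, B x i * A i y =
        (if (π i.succ)⁻¹ x = y then 1 else 0) - (if (π i.castSucc)⁻¹ x = y then 1 else 0) := by
      intro i
      obtain ⟨z, rfl⟩ := (π i.castSucc).surjective x
      simp only [A, B, Matrix.of_apply, hπ, mul_inv_rev, Equiv.Perm.mul_apply,
        Equiv.Perm.coe_inv, Equiv.symm_apply_apply, EmbeddingLike.apply_eq_iff_eq, hg, Equiv.symm_swap,
        Equiv.swap_apply_def]
      split_ifs <;> simp_all
    have htel : ∀ F : Fin (k + 1) → ℚ, ∑ i : Fin k, (F i.succ - F i.castSucc) =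
        F (Fin.last k) - F 0 := by
      intro F
      rw [Finset.sum_sub_distrib]
      linarith [Fin.sum_univ_succ F, Fin.sum_univ_castSucc F]
    rw [Matrix.mul_apply, Finset.sum_congr rfl fun i _ => hterm i,
      htel fun j => if (π j)⁻¹ x = y then 1 else 0, hπk, hπ0]
    simp
  have hrank := Matrix.rank_add_rank_le_card_of_mul_eq_zero hBA
  rw [Matrix.rank_transpose] at hB
  simp at hrank
  omega

/-- A permutation matrix of a transposition, as an invertible matrix lying in `G(m,p,N)`. -/
theorem exists_swap_mem_GmpN (m p : ℕ) {N : ℕ} (x y : Fin N) :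
    ∃ g : GL (Fin N) ℂ, (g : Matrix (Fin N) (Fin N) ℂ) ∈ GmpN m p N ∧
      HasPermSupport (g : Matrix (Fin N) (Fin N) ℂ) (Equiv.swap x y) := by
  let P : Matrix (Fin N) (Fin N) ℂ :=
    Matrix.of fun i j => if i = Equiv.swap x y j then 1 else 0
  have hP : P * P = 1 := by
    ext i j
    simp [P, Matrix.mul_apply, Matrix.one_apply]
  exact ⟨⟨P, P, hP, hP⟩, ⟨Equiv.swap x y, fun _ => 1, by simp, by simp, fun i j => rfl⟩,
    fun i j => by simp [P]⟩

theorem exists_hasPermSupport_of_mem_GmpN {m p N : ℕ} (hm : 0 < m)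
    {A : Matrix (Fin N) (Fin N) ℂ} (hA : A ∈ GmpN m p N) : ∃ σ, HasPermSupport A σ := by
  obtain ⟨σ, f, hf, -, h⟩ := hA
  refine ⟨σ, fun i j => ?_⟩
  have hj : f j ≠ 0 := by
    intro h0
    simpa [h0, hm.ne'] using hf j
  rw [h]
  simp [hj]

theorem stmt0 (N m p : ℕ) (hN : 5 ≤ N) (hm : 0 < m) (hp : 0 < p) (hpm : p ∣ m) :
    ¬ ∃ s : Fin (N + 2) → GL (Fin N) ℂ,
      (∀ i, (s i : Matrix (Fin N) (Fin N) ℂ) ∈ GmpN m p N) ∧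
      (List.ofFn s).prod = 1 ∧
      (∀ i : Fin (N + 2), (i : ℕ) < N + 1 →
        IsPseudoreflection (s i : Matrix (Fin N) (Fin N) ℂ)) ∧
      (∃ (μ : ℂ) (R : Matrix (Fin N) (Fin N) ℂ), IsPseudoreflection R ∧
        (s (Fin.last (N + 1)) : Matrix (Fin N) (Fin N) ℂ) = μ • R) ∧
      (∀ g : GL (Fin N) ℂ, g ∈ Subgroup.closure (Set.range s) ↔
        (g : Matrix (Fin N) (Fin N) ℂ) ∈ GmpN m p N) := by
  rintro ⟨s, hmem, hprod, hrefl, ⟨μ, R, hR, hμ⟩, hgen⟩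
  have : Nonempty (Fin N) := ⟨⟨0, by omega⟩⟩
  choose σ hσ using fun i => exists_hasPermSupport_of_mem_GmpN hm (hmem i)
  have hswap : ∀ i, ∃ a b, σ i = Equiv.swap a b := by
    intro i
    rcases Nat.lt_or_ge i (N + 1) with hi | hi
    · refine (hσ i).exists_eq_swap one_ne_zero ?_
      rw [one_smul]
      exact (hrefl i hi).le
    · obtain rfl : i = Fin.last (N + 1) := Fin.ext (by simp; omega)
      have hμ0 : μ ≠ 0 := by
        rintro rfl
        have hne := (hσ (Fin.last (N + 1)) _ ⟨0, by omega⟩).2 rfl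
        rw [hμ] at hne
        simp at hne
      refine (hσ _).exists_eq_swap hμ0 ?_
      rw [hμ, ← smul_sub, Matrix.rank_smul_of_mem_nonZeroDivisors _
        (mem_nonZeroDivisors_of_ne_zero hμ0)]
      exact hR.le
  choose a b hab using hswap
  have hperm : (List.ofFn fun i => Equiv.swap (a i) (b i)).prod = 1 := by
    simp only [← hab]
    have h := HasPermSupport.list_prod hσ
    rw [hprod] at h
    exact h.unique HasPermSupport.one
  have hcard := two_mul_card_le_of_prod_swap_eq_one a b hperm fun ψ hψ x y => by
    have hinv : ∀ g ∈ Subgroup.closure (Set.range s), ∃ τ,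
        HasPermSupport (g : Matrix (Fin N) (Fin N) ℂ) τ ∧ ∀ z, ψ (τ z) = ψ z := by
      intro g hg
      induction hg using Subgroup.closure_induction with
      | mem g hg =>
        obtain ⟨i, rfl⟩ := hg
        refine ⟨σ i, hσ i, fun z => ?_⟩
        have hi := hψ i
        rw [hab, Equiv.swap_apply_def]
        split_ifs <;> simp_all
      | one => exact ⟨1, HasPermSupport.one, fun _ => rfl⟩
      | mul g h _ _ ihg ihh =>
        obtain ⟨τ, hτ, hτψ⟩ := ihg
        obtain ⟨ρ, hρ, hρψ⟩ := ihh
        exact ⟨τ * ρ, hτ.mul hρ, fun z => by rw [Equiv.Perm.mul_apply, hτψ, hρψ]⟩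
      | inv g _ ih =>
        obtain ⟨τ, hτ, hτψ⟩ := ih
        exact ⟨τ⁻¹, hτ.inv, fun z => by rw [← hτψ (τ⁻¹ z), Equiv.Perm.coe_inv, Equiv.apply_symm_apply]⟩
    obtain ⟨g, hg, hgs⟩ := exists_swap_mem_GmpN m p x y
    obtain ⟨τ, hτ, hτψ⟩ := hinv g ((hgen g).2 hg)
    rw [← hτψ x, hτ.unique hgs, Equiv.swap_apply_left]
  rw [Fintype.card_fin] at hcard
  omega
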